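/- Let A = (Σ, Q, Q₀, δ, α) be a GFG Rabin automaton whose language is recognized by some GFG Büchi automaton, and let g be a finite-state strategy such that A is strongly tight with respect to g. Then no state q of A that appears in some good set Fᵢ of the Rabin condition lies on a rejecting cycle of A, i.e., on a cycle of A whose set of states does not satisfy α. -/

import Mathlib

namespace GFG

/-- The structure of a nondeterministic automaton on infinite words:
alphabet `A`, states `Q`, initial states and transition function.
The acceptance condition is kept separate, as a predicate on the set
of states visited infinitely often. -/
structure Auto (A Q : Type) where
  init : Set Q
  next : Q → A → Set Q

variable {A Q Mem : Type}

/-- `r` is a run of the automaton `M` on the infinite word `w`. -/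
def Auto.IsRun (M : Auto A Q) (w : ℕ → A) (r : ℕ → Q) : Prop :=
  r 0 ∈ M.init ∧ ∀ i, r (i + 1) ∈ M.next (r i) (w i)

/-- The set of states occurring infinitely often in `r`. -/
def InfOcc (r : ℕ → Q) : Set Q := {q | ∀ n, ∃ m, n ≤ m ∧ r m = q}

/-- The language of `M` with acceptance condition `acc` (a predicate on `inf(r)`). -/
def Auto.Lang (M : Auto A Q) (acc : Set Q → Prop) : Set (ℕ → A) :=
  {w | ∃ r, M.IsRun w r ∧ acc (InfOcc r)}

/-- `M` is deterministic: one initial state and at most one successor per state/letter. -/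
def Auto.IsDet (M : Auto A Q) : Prop :=
  (∃ q0, M.init = {q0}) ∧ ∀ q a, (M.next q a).Subsingleton

/-- `A^q`: the automaton `M` with set of initial states `{q}`. -/
def Auto.withInit (M : Auto A Q) (q : Q) : Auto A Q := ⟨{q}, M.next⟩

/-- Büchi condition: `inf(r) ∩ α ≠ ∅`. -/
def BuchiAcc (α : Set Q) (S : Set Q) : Prop := (S ∩ α).Nonempty

/-- co-Büchi condition: `inf(r) ∩ α = ∅`. -/
def CoBuchiAcc (α : Set Q) (S : Set Q) : Prop := S ∩ α = ∅

/-- Rabin condition with bad sets `E i` and good sets `F i`. -/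
def RabinAcc {ι : Type} (E F : ι → Set Q) (S : Set Q) : Prop :=
  ∃ i, S ∩ E i = ∅ ∧ (S ∩ F i).Nonempty

/-- Streett condition with pairs `(E i, F i)`. -/
def StreettAcc {ι : Type} (E F : ι → Set Q) (S : Set Q) : Prop :=
  ∀ i, S ∩ E i = ∅ ∨ (S ∩ F i).Nonempty

/-- Parity condition: the minimal priority seen infinitely often is even. -/
def ParityAcc (c : Q → ℕ) (S : Set Q) : Prop := Even (sInf (c '' S))

/-- The prefix of length `n` of the infinite word `w`, as a list. -/
def prefixWord (w : ℕ → A) (n : ℕ) : List A := (List.range n).map w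

/-- The run induced by a strategy `g : A* → Q` on the word `w`:
`g(ε), g(a₁), g(a₁a₂), …`. -/
def StrategyRun (g : List A → Q) (w : ℕ → A) : ℕ → Q := fun n => g (prefixWord w n)

/-- `g` witnesses GFGness of `M` (with acceptance `acc`): for every word `w` the
induced sequence is a run of `M` on `w`, accepting whenever `w ∈ L(M)`. -/
def IsGFGStrategy (M : Auto A Q) (acc : Set Q → Prop) (g : List A → Q) : Prop :=
  ∀ w : ℕ → A, M.IsRun w (StrategyRun g w) ∧
    (w ∈ M.Lang acc → acc (InfOcc (StrategyRun g w)))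

/-- `M` is good for games. -/
def IsGFG (M : Auto A Q) (acc : Set Q → Prop) : Prop :=
  ∃ g : List A → Q, IsGFGStrategy M acc g

/-- `M` is unambiguous: every word of the language has exactly one accepting run. -/
def Unambiguous (M : Auto A Q) (acc : Set Q → Prop) : Prop :=
  ∀ w ∈ M.Lang acc, ∃! r : ℕ → Q, M.IsRun w r ∧ acc (InfOcc r)

/-- `M` is determinizable by pruning. -/
def DetByP (M : Auto A Q) (acc : Set Q → Prop) : Prop :=
  ∃ q0 ∈ M.init, ∃ next' : Q → A → Set Q,
    (∀ q a, next' q a ⊆ M.next q a ∧ (next' q a).Subsingleton) ∧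
    (⟨{q0}, next'⟩ : Auto A Q).Lang acc = M.Lang acc

/-- A finite-state strategy (transducer): memories `Mem`, initial memory `m0`,
memory update function `upd` and output function `out`. -/
structure Transducer (A Q Mem : Type) where
  m0 : Mem
  upd : Mem → A → Mem
  out : Mem → Q

namespace Transducer

variable (T : Transducer A Q Mem)

/-- The memory reached from `m` after reading the finite word `u`. -/
def run (m : Mem) (u : List A) : Mem := u.foldl T.upd m

/-- The strategy generated by the transducer: `u ↦ τ(ρ(m₀, u))`. -/
def strategy : List A → Q := fun u => T.out (T.run T.m0 u)

/-- The deterministic automaton `A_g`, with initial memory replaced by `m`. -/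
def autoFrom (m : Mem) : Auto A Mem := ⟨{m}, fun m' a => {T.upd m' a}⟩

/-- The deterministic automaton `A_g` itself. -/
def auto : Auto A Mem := T.autoFrom T.m0

/-- The acceptance condition `α_g` of `A_g`, obtained from `acc` by replacing each
set `F ⊆ Q` appearing in it by `{m | τ(m) ∈ F}`. -/
def accG (acc : Set Q → Prop) : Set Mem → Prop := fun S => acc (T.out '' S)

/-- `m` is reachable in `A_g` from the initial memory. -/
def Reachable (m : Mem) : Prop := ∃ u : List A, T.run T.m0 u = m

/-- The set of memories visited along the path of `A_g` that starts at `m` and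
reads the finite word `u` (both endpoints included). -/
def pathStates (m : Mem) (u : List A) : Set Mem :=
  {m' | ∃ v : List A, v <+: u ∧ T.run m v = m'}

/-- `P_{src → dst}`: the (words inducing the) finite paths of `A_g` from `src` to `dst`. -/
def PathSet (src dst : Mem) : Set (List A) :=
  {u : List A | u ≠ [] ∧ T.run src u = dst}

/-- Every combination of paths from `P_{src → dst}` satisfies `α_g`. -/
def AllCombosAcc (acc : Set Q → Prop) (src dst : Mem) : Prop :=
  ∀ S : Set (List A), S.Nonempty → S ⊆ T.PathSet src dst →
    T.accG acc (⋃ u ∈ S, T.pathStates src u)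

/-- `P_{src → dst}` is empty, or every combination of its paths satisfies `α_g`. -/
def GoodPathSet (acc : Set Q → Prop) (src dst : Mem) : Prop :=
  T.PathSet src dst = ∅ ∨ T.AllCombosAcc acc src dst

/-- `m` is replaceable by `m'`: the set `P_{m' → m}` of paths of `A_g` from `m'`
to `m` is empty, or every combination of its paths satisfies `α_g`. -/
def Replaceable (acc : Set Q → Prop) (m m' : Mem) : Prop :=
  T.GoodPathSet acc m' m

/-- The transition `(q, a, q')` is used by the strategy. -/
def Uses (q : Q) (a : A) (q' : Q) : Prop :=
  ∃ u : List A, T.strategy u = q ∧ T.strategy (u ++ [a]) = q'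

/-- The nonempty word `u` induces a cycle of `A_g` through the memory `m`. -/
def CycleThrough (m : Mem) (u : List A) : Prop := u ≠ [] ∧ T.run m u = m

/-- The cycle of `A_g` through `m` induced by `u` is accepting. -/
def AccCycle (acc : Set Q → Prop) (m : Mem) (u : List A) : Prop :=
  T.CycleThrough m u ∧ T.accG acc (T.pathStates m u)

/-- The cycle of `A_g` through `m` induced by `u` is rejecting. -/
def RejCycle (acc : Set Q → Prop) (m : Mem) (u : List A) : Prop :=
  T.CycleThrough m u ∧ ¬ T.accG acc (T.pathStates m u)

/-- The cycle of `A_g` through `m` induced by `u` is `q`-exclusive accepting: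
it is accepting, but its set of memories minus the memories of `q` is not. -/
def ExclAccCycle (acc : Set Q → Prop) (q : Q) (m : Mem) (u : List A) : Prop :=
  T.CycleThrough m u ∧ T.accG acc (T.pathStates m u) ∧
    ¬ T.accG acc (T.pathStates m u \ {m' : Mem | T.out m' = q})

end Transducer

/-- `M` is weakly tight with respect to `T`: every transition of `M` is used. -/
def WeaklyTightWrt (M : Auto A Q) (T : Transducer A Q Mem) : Prop :=
  ∀ q a q', q' ∈ M.next q a → T.Uses q a q'

/-- `M` is tight with respect to `T`: every transition of `M` is used, and no memory
is replaceable by a different memory of the same state. -/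
def TightWrt (M : Auto A Q) (acc : Set Q → Prop) (T : Transducer A Q Mem) : Prop :=
  WeaklyTightWrt M T ∧
  ∀ m m' : Mem, m ≠ m' → T.out m = T.out m' → ¬ T.Replaceable acc m m'

/-- `M` is tight: tight with respect to some finite-state strategy witnessing its GFGness. -/
def Tight (M : Auto A Q) (acc : Set Q → Prop) : Prop :=
  ∃ (Mem : Type) (_ : Fintype Mem) (T : Transducer A Q Mem),
    IsGFGStrategy M acc T.strategy ∧ TightWrt M acc T

/-- `M` is weakly tight: weakly tight with respect to some finite-state strategy
witnessing its GFGness. -/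
def WeaklyTight (M : Auto A Q) (acc : Set Q → Prop) : Prop :=
  ∃ (Mem : Type) (_ : Fintype Mem) (T : Transducer A Q Mem),
    IsGFGStrategy M acc T.strategy ∧ WeaklyTightWrt M T

/-- A Rabin automaton `M` (with pairs `(E i, F i)`) is strongly tight with respect to `T`:
tight, and every state appearing in some good set has a `q`-exclusive accepting cycle
in `A_g`. -/
def StronglyTightWrt {ι : Type} (M : Auto A Q) (E F : ι → Set Q)
    (T : Transducer A Q Mem) : Prop :=
  TightWrt M (RabinAcc E F) T ∧
  ∀ q : Q, (∃ i, q ∈ F i) →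
    ∃ (m : Mem) (u : List A), T.ExclAccCycle (RabinAcc E F) q m u

/-- A Rabin automaton is strongly tight: strongly tight with respect to some finite-state
strategy witnessing its GFGness. -/
def StronglyTight {ι : Type} (M : Auto A Q) (E F : ι → Set Q) : Prop :=
  ∃ (Mem : Type) (_ : Fintype Mem) (T : Transducer A Q Mem),
    IsGFGStrategy M (RabinAcc E F) T.strategy ∧ StronglyTightWrt M E F T

/-- One-step reachability in the transition graph of `M`. -/
def Auto.Step (M : Auto A Q) (q q' : Q) : Prop := ∃ a, q' ∈ M.next q a

/-- Reachability in the transition graph of `M`. -/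
def Auto.Reach (M : Auto A Q) : Q → Q → Prop := Relation.ReflTransGen M.Step

/-- The Büchi automaton `(M, α)` is weak: each strongly connected component is either
contained in `α` or disjoint from `α`. -/
def Auto.IsWeak (M : Auto A Q) (α : Set Q) : Prop :=
  ∀ q q', M.Reach q q' → M.Reach q' q → (q ∈ α ↔ q' ∈ α)

section Helpers

theorem rabin_union {Q ι : Type} {E F : ι → Set Q} {S S' : Set Q}
    (h : ¬ RabinAcc E F S) (h' : ¬ RabinAcc E F S') : ¬ RabinAcc E F (S ∪ S') := by
  rintro ⟨i, h1, x, hx, hF⟩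
  rw [Set.union_inter_distrib_right, Set.union_empty_iff] at h1
  rcases hx with hx | hx
  · exact h ⟨i, h1.1, x, hx, hF⟩
  · exact h' ⟨i, h1.2, x, hx, hF⟩

theorem run_append {A Q Mem : Type} (T : Transducer A Q Mem) (m : Mem) (u v : List A) :
    T.run m (u ++ v) = T.run (T.run m u) v := by
  simp [Transducer.run, List.foldl_append]

theorem pathStates_append {A Q Mem : Type} (T : Transducer A Q Mem) (m : Mem) (u v : List A) :
    T.pathStates m (u ++ v) = T.pathStates m u ∪ T.pathStates (T.run m u) v := by
  ext x
  constructor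
  · rintro ⟨p, hp, rfl⟩
    obtain ⟨s, hs⟩ := hp
    rcases List.append_eq_append_iff.1 hs with ⟨t, h1, h2⟩ | ⟨t, h1, h2⟩
    · exact Or.inl ⟨p, ⟨t, h1.symm⟩, rfl⟩
    · exact Or.inr ⟨t, ⟨s, h2.symm⟩, by rw [h1, run_append]⟩
  · rintro (⟨p, hp, rfl⟩ | ⟨p, hp, rfl⟩)
    · exact ⟨p, hp.trans (List.prefix_append _ _), rfl⟩
    · exact ⟨u ++ p, (List.prefix_append_right_inj u).2 hp, by rw [run_append]⟩

theorem start_mem {A Q Mem : Type} (T : Transducer A Q Mem) (m : Mem) (u : List A) :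
    m ∈ T.pathStates m u := ⟨[], List.nil_prefix, rfl⟩

theorem end_mem {A Q Mem : Type} (T : Transducer A Q Mem) (m : Mem) (u : List A) :
    T.run m u ∈ T.pathStates m u := ⟨u, List.prefix_rfl, rfl⟩

/-- limit word of an increasing sequence of finite words -/
theorem limit_word {A : Type} (P b : ℕ → List A) (hP : ∀ k, P (k+1) = P k ++ b k)
    (hb : ∀ k, b k ≠ []) :
    (∀ k, k ≤ (P k).length) ∧
    ∃ w : ℕ → A, ∀ k j, j ≤ (P k).length → prefixWord w j = (P k).take j := by
  have hlen : ∀ k, k ≤ (P k).length := by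
    intro k
    induction k with
    | zero => simp
    | succ k ih =>
      have := List.length_pos_iff.2 (hb k)
      rw [hP]; simp; omega
  have hpre : ∀ k l, k ≤ l → P k <+: P l := by
    intro k l h
    induction l, h using Nat.le_induction with
    | base => exact List.prefix_rfl
    | succ l _ ih => rw [hP]; exact ih.trans (List.prefix_append _ _)
  refine ⟨hlen, fun i => (P (i+1))[i]'(hlen (i+1)), ?_⟩
  intro k j hj
  apply List.ext_getElem
  · simp [prefixWord, hj]
  · intro i h1 h2
    simp only [prefixWord, List.getElem_map, List.getElem_range, List.getElem_take]
    simp [prefixWord] at h1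
    rcases le_total k (i+1) with h | h
    · exact ((hpre _ _ h).getElem (by omega)).symm
    · exact (hpre _ _ h).getElem _

theorem limit_inf {A Q Mem : Type} (T : Transducer A Q Mem) (m : Mem) (S : Set Mem)
    (P b : ℕ → List A) (hP : ∀ k, P (k+1) = P k ++ b k) (hb : ∀ k, b k ≠ [])
    (h0 : T.run T.m0 (P 0) = m) (hr : ∀ k, T.run m (b k) = m)
    (hS : ∀ k, T.pathStates m (b k) = S) :
    (∀ k, k ≤ (P k).length) ∧
    ∃ w : ℕ → A, (∀ k j, j ≤ (P k).length → prefixWord w j = (P k).take j) ∧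
      InfOcc (StrategyRun T.strategy w) = T.out '' S := by
  obtain ⟨hlen, w, hw⟩ := limit_word P b hP hb
  have hrun : ∀ k, T.run T.m0 (P k) = m := by
    intro k
    induction k with
    | zero => exact h0
    | succ k ih => rw [hP, run_append, ih, hr]
  have key : ∀ k v, v <+: b k → prefixWord w ((P k).length + v.length) = P k ++ v := by
    intro k v hv
    rw [hw (k+1) _ (by rw [hP]; simp [hv.length_le])]
    rw [hP, List.take_length_add_append, ← List.prefix_iff_eq_take.1 hv]
  refine ⟨hlen, w, hw, ?_⟩
  ext x
  constructor
  · intro hx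
    obtain ⟨j, hj, rfl⟩ := hx (P 0).length
    have : ∃ k, j < (P k).length := ⟨j+1, hlen (j+1)⟩
    classical
    obtain ⟨hk, hmin⟩ := (⟨Nat.find_spec this, fun l => Nat.find_min this⟩ : _ ∧ ∀ l, l < Nat.find this → _)
    generalize Nat.find this = k at hk hmin
    rcases k with _ | k
    · omega
    · have hk' := hmin k (by omega)
      push Not at hk'
      refine ⟨T.run m ((b k).take (j - (P k).length)), ?_, ?_⟩
      · rw [← hS k]; exact ⟨_, List.take_prefix _ _, rfl⟩
      · have hl : (b k).length = (P (k+1)).length - (P k).length := by rw [hP]; simp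
        have := key k _ (List.take_prefix (j - (P k).length) (b k))
        rw [List.length_take, min_eq_left (by omega), Nat.add_sub_cancel' hk'] at this
        rw [StrategyRun, this, Transducer.strategy, run_append, hrun]
  · rintro ⟨s, hs, rfl⟩ n
    rw [← hS n] at hs
    obtain ⟨v, hv, rfl⟩ := hs
    refine ⟨(P n).length + v.length, (hlen n).trans (by omega), ?_⟩
    rw [StrategyRun, key n v hv, Transducer.strategy, run_append, hrun]

theorem flat_succ {A : Type} (c : List A) (k : ℕ) :
    (List.replicate (k+1) c).flatten = (List.replicate k c).flatten ++ c := by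
  simp [List.replicate_succ']

theorem landweber {A Q Mem Q' : Type} [Fintype Q']
    (M : Auto A Q) (acc : Set Q → Prop) (T : Transducer A Q Mem)
    (hg : IsGFGStrategy M acc T.strategy) (B : Auto A Q') (β : Set Q')
    (hB : IsGFG B (BuchiAcc β)) (hL : B.Lang (BuchiAcc β) = M.Lang acc)
    (u c d : List A) (m : Mem) (hu : T.run T.m0 u = m) (hc0 : c ≠ [])
    (hc : T.run m c = m) (hd : T.run m d = m) (hacc : T.accG acc (T.pathStates m c)) :
    T.accG acc (T.pathStates m c ∪ T.pathStates m d) := by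
  obtain ⟨h, hh⟩ := hB
  have hrep : ∀ k, T.run m (List.replicate k c).flatten = m := by
    intro k
    induction k with
    | zero => rfl
    | succ k ih => rw [flat_succ, run_append, ih, hc]
  have hrepS : ∀ k, T.pathStates m (List.replicate (k+1) c).flatten = T.pathStates m c := by
    intro k
    induction k with
    | zero => simp
    | succ k ih => rw [flat_succ, pathStates_append, ih, hrep]; simp
  have step : ∀ P : List A, ∃ b : List A, T.run T.m0 P = m →
      b ≠ [] ∧ T.run m b = m ∧ T.pathStates m b = T.pathStates m c ∪ T.pathStates m d ∧
      ∃ v, v <+: b ∧ h (P ++ v) ∈ β := by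
    intro P
    by_cases hPm : T.run T.m0 P = m
    swap
    · exact ⟨[], fun h => absurd h hPm⟩
    obtain ⟨hlen, w, hw, hinf⟩ := limit_inf T m (T.pathStates m c)
      (fun k => P ++ (List.replicate k c).flatten) (fun _ => c)
      (fun k => by simp only [flat_succ, List.append_assoc]) (fun _ => hc0) (by simpa using hPm)
      (fun _ => hc) (fun _ => rfl)
    have hwM : w ∈ M.Lang acc := ⟨_, (hg w).1, by rw [hinf]; exact hacc⟩
    rw [← hL] at hwM
    obtain ⟨x, hx, hxβ⟩ := (hh w).2 hwM
    obtain ⟨j, hj, rfl⟩ := hx (P.length + 1)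
    obtain ⟨k, hk⟩ : ∃ k, j ≤ (P ++ (List.replicate k c).flatten).length := ⟨j, hlen j⟩
    rcases k with _ | k
    · simp at hk; omega
    have hpw := hw (k+1) j hk
    refine ⟨(List.replicate (k+1) c).flatten ++ d, fun _ => ⟨?_, ?_, ?_, ?_⟩⟩
    · simp [hc0, List.replicate_succ]
    · rw [run_append, hrep, hd]
    · rw [pathStates_append, hrep, hrepS]
    · refine ⟨((List.replicate (k+1) c).flatten).take (j - P.length),
        (List.take_prefix _ _).trans (List.prefix_append _ _), ?_⟩
      rw [StrategyRun, hpw, List.take_append, List.take_of_length_le (by omega)] at hxβ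
      exact hxβ
  choose nb hnb using step
  let P : ℕ → List A := fun k => Nat.rec u (fun _ p => p ++ nb p) k
  have hPs : ∀ k, P (k+1) = P k ++ nb (P k) := fun k => rfl
  have hPm : ∀ k, T.run T.m0 (P k) = m := by
    intro k
    induction k with
    | zero => exact hu
    | succ k ih => rw [hPs, run_append, ih, (hnb _ ih).2.1]
  obtain ⟨hlen, w, hw, hinf⟩ := limit_inf T m (T.pathStates m c ∪ T.pathStates m d) P
    (fun k => nb (P k)) hPs (fun k => (hnb _ (hPm k)).1) (hPm 0)
    (fun k => (hnb _ (hPm k)).2.1) (fun k => (hnb _ (hPm k)).2.2.1)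
  have hfreq : ∀ n, ∃ j, n ≤ j ∧ StrategyRun h w j ∈ β := by
    intro n
    obtain ⟨v, hv, hvβ⟩ := (hnb _ (hPm n)).2.2.2
    refine ⟨(P n).length + v.length, (hlen n).trans (by omega), ?_⟩
    rw [StrategyRun, hw (n+1) _ (by rw [hPs]; simp [hv.length_le]), hPs,
      List.take_length_add_append, ← List.prefix_iff_eq_take.1 hv]
    exact hvβ
  have hex : ∃ x ∈ β, x ∈ InfOcc (StrategyRun h w) := by
    by_contra hcon
    push Not at hcon
    have : ∀ x : Q', ∃ n, x ∈ β → ∀ j, n ≤ j → StrategyRun h w j ≠ x := by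
      intro x
      by_cases hx : x ∈ β
      · have := hcon x hx
        simp only [InfOcc, Set.mem_setOf_eq, not_forall, not_exists, not_and] at this
        obtain ⟨n, hn⟩ := this
        exact ⟨n, fun _ => hn⟩
      · exact ⟨0, fun h => absurd h hx⟩
    choose N hN using this
    obtain ⟨j, hj, hjβ⟩ := hfreq (Finset.univ.sup N)
    exact hN _ hjβ j ((Finset.le_sup (Finset.mem_univ _)).trans hj) rfl
  obtain ⟨x, hxβ, hx⟩ := hex
  have hwB : w ∈ B.Lang (BuchiAcc β) := ⟨_, (hh w).1, x, hx, hxβ⟩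
  rw [hL] at hwB
  have := (hg w).2 hwB
  rw [hinf] at this
  exact this

theorem connect {A Q Mem ι : Type} [Fintype Mem] (M : Auto A Q) (E F : ι → Set Q)
    (T : Transducer A Q Mem) (ht : TightWrt M (RabinAcc E F) T) (m m' : Mem)
    (hne : m ≠ m') (ho : T.out m = T.out m') :
    ∃ v, T.run m v = m' ∧ ¬ T.accG (RabinAcc E F) (T.pathStates m v) := by
  have aux : ∀ a b : Mem, a ≠ b → T.out a = T.out b → ∃ S : Set (List A), S.Nonempty ∧
      S ⊆ T.PathSet a b ∧ ¬ T.accG (RabinAcc E F) (⋃ u ∈ S, T.pathStates a u) := by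
    intro a b hab hO
    have := ht.2 b a hab.symm hO.symm
    simp only [Transducer.Replaceable, Transducer.GoodPathSet, Transducer.AllCombosAcc, not_or,
      not_forall] at this
    obtain ⟨_, S, h1, h2, h3⟩ := this
    exact ⟨S, h1, h2, h3⟩
  obtain ⟨S1, ⟨p0, hp0⟩, hS1, hr1⟩ := aux m m' hne ho
  obtain ⟨S2, ⟨r0, hr0⟩, hS2, hr2⟩ := aux m' m hne.symm ho.symm
  set U1 := ⋃ u ∈ S1, T.pathStates m u with hU1
  set U2 := ⋃ u ∈ S2, T.pathStates m' u with hU2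
  have hrej : ¬ T.accG (RabinAcc E F) (U1 ∪ U2) := by
    unfold Transducer.accG
    rw [Set.image_union]
    exact rabin_union hr1 hr2
  have s1 : ∀ p ∈ S1, T.pathStates m p ⊆ U1 ∪ U2 := fun p hp x hx =>
    Or.inl (Set.mem_biUnion hp hx)
  have s2 : ∀ p ∈ S2, T.pathStates m' p ⊆ U1 ∪ U2 := fun p hp x hx =>
    Or.inr (Set.mem_biUnion hp hx)
  have cover : ∀ Y : Set Mem, Y.Finite → Y ⊆ U1 ∪ U2 → ∃ v, T.run m v = m' ∧
      Y ⊆ T.pathStates m v ∧ T.pathStates m v ⊆ U1 ∪ U2 := by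
    intro Y hY
    induction Y, hY using Set.Finite.induction_on with
    | empty => exact fun _ => ⟨p0, (hS1 hp0).2, Set.empty_subset _, s1 _ hp0⟩
    | @insert y Y _ _ ih =>
      intro hsub
      obtain ⟨v, hv, hv1, hv2⟩ := ih ((Set.subset_insert _ _).trans hsub)
      have main : ∀ r ∈ S2, ∀ p ∈ S1, (y ∈ T.pathStates m' r ∨ y ∈ T.pathStates m p) →
          ∃ v, T.run m v = m' ∧ insert y Y ⊆ T.pathStates m v ∧
            T.pathStates m v ⊆ U1 ∪ U2 := by
        intro r hr p hp hy
        refine ⟨v ++ (r ++ p), ?_, ?_, ?_⟩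
        · rw [run_append, run_append, hv, (hS2 hr).2, (hS1 hp).2]
        · rw [pathStates_append, pathStates_append, hv, (hS2 hr).2]
          exact Set.insert_subset (Or.inr hy) (fun z hz => Or.inl (hv1 hz))
        · rw [pathStates_append, pathStates_append, hv, (hS2 hr).2]
          exact Set.union_subset hv2 (Set.union_subset (s2 _ hr) (s1 _ hp))
      rcases hsub (Set.mem_insert _ _) with hy | hy
      · obtain ⟨p, hp, hy⟩ := Set.mem_iUnion₂.1 hy
        exact main r0 hr0 p hp (Or.inr hy)
      · obtain ⟨r, hr, hy⟩ := Set.mem_iUnion₂.1 hy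
        exact main r hr p0 hp0 (Or.inl hy)
  obtain ⟨v, hv, h1, h2⟩ := cover _ (Set.toFinite _) subset_rfl
  exact ⟨v, hv, by rwa [h2.antisymm h1]⟩

theorem chain_rtg {Q : Type} (R : Q → Q → Prop) (l : List Q) (hl : l.IsChain R)
    (i j : ℕ) (hij : i ≤ j) (hj : j < l.length) :
    Relation.ReflTransGen (fun x y => R x y ∧ y ∈ l) (l[i]'(by omega)) (l[j]) := by
  induction j, hij using Nat.le_induction with
  | base => exact .refl
  | succ j hij ih =>
    exact (ih (by omega)).tail ⟨List.isChain_iff_getElem.1 hl j hj, List.getElem_mem _⟩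

theorem stmt14_core {A Q Mem ι : Type} [Fintype Mem]
    (M : Auto A Q) (E F : ι → Set Q) (T : Transducer A Q Mem)
    (ht : TightWrt M (RabinAcc E F) T) (l : List Q) (m : Mem)
    (huniq : ∀ m', T.out m' = T.out m → m' = m) (hml : T.out m ∈ l)
    (hrej : ¬ RabinAcc E F {x : Q | x ∈ l})
    (hconn : ∀ x ∈ l, Relation.ReflTransGen (fun x y => M.Step x y ∧ y ∈ l) (T.out m) x ∧
      Relation.ReflTransGen (fun x y => M.Step x y ∧ y ∈ l) x (T.out m)) :
    ∃ d, T.run m d = m ∧ ¬ T.accG (RabinAcc E F) (T.pathStates m d) := by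
  set L := {x : Q | x ∈ l} with hL
  -- extending paths
  have ext : ∀ x y, Relation.ReflTransGen (fun x y => M.Step x y ∧ y ∈ l) x y → x ∈ l →
      ∀ m1, T.out m1 = x → ∃ u, T.out (T.run m1 u) = y ∧
        ¬ RabinAcc E F (T.out '' T.pathStates m1 u ∪ L) := by
    intro x y hxy hx m1 hm1
    induction hxy with
    | refl =>
      refine ⟨[], hm1, ?_⟩
      have : T.out '' T.pathStates m1 [] ∪ L = L := by
        apply Set.union_eq_right.2
        rintro _ ⟨s, ⟨v, hv, rfl⟩, rfl⟩
        rw [List.prefix_nil.1 hv]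
        change T.out m1 ∈ l
        rwa [hm1]
      rwa [this]
    | @tail y z _ hyz ih =>
      obtain ⟨u, hu, hur⟩ := ih
      obtain ⟨⟨a, ha⟩, hz⟩ := hyz
      obtain ⟨p, hp1, hp2⟩ := ht.1 _ _ _ ha
      unfold Transducer.strategy at hp1 hp2
      rw [run_append] at hp2
      set n := T.run T.m0 p with hn
      obtain ⟨u', hu', hur'⟩ : ∃ u', T.run m1 u' = n ∧
          ¬ RabinAcc E F (T.out '' T.pathStates m1 u' ∪ L) := by
        by_cases hne : T.run m1 u = n
        · exact ⟨u, hne, hur⟩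
        · obtain ⟨v, hv, hvr⟩ := connect M E F T ht _ _ hne (hu.trans hp1.symm)
          refine ⟨u ++ v, by rw [run_append, hv], ?_⟩
          rw [pathStates_append, Set.image_union, Set.union_right_comm]
          exact rabin_union hur hvr
      refine ⟨u' ++ [a], by rw [run_append, hu', hp2], ?_⟩
      have : T.out '' T.pathStates m1 (u' ++ [a]) ∪ L = T.out '' T.pathStates m1 u' ∪ L := by
        apply Set.Subset.antisymm
        · rw [pathStates_append, Set.image_union]
          apply Set.union_subset _ Set.subset_union_right
          apply Set.union_subset Set.subset_union_left
          rintro _ ⟨s, ⟨v, hv, rfl⟩, rfl⟩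
          rcases List.prefix_concat_iff (l₂ := ([] : List A)) |>.1 hv with h | h
          · subst h
            right
            change T.out (T.run (T.run m1 u') [a]) ∈ l
            rw [hu', hp2]; exact hz
          · rw [List.prefix_nil.1 h]
            left
            exact ⟨_, end_mem T m1 u', rfl⟩
        · rw [pathStates_append, Set.image_union]
          exact Set.union_subset_union_left _ Set.subset_union_left
      rwa [this]
  have cover : ∀ Y : Set Q, Y.Finite → Y ⊆ L → ∃ d, T.run m d = m ∧
      Y ⊆ T.out '' T.pathStates m d ∧ ¬ RabinAcc E F (T.out '' T.pathStates m d ∪ L) := by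
    intro Y hY
    induction Y, hY using Set.Finite.induction_on with
    | empty =>
      intro _
      obtain ⟨u, hu, hur⟩ := ext _ _ .refl hml m rfl
      exact ⟨u, huniq _ hu, Set.empty_subset _, hur⟩
    | @insert y Y _ _ ih =>
      intro hsub
      obtain ⟨d, hd, hdY, hdr⟩ := ih ((Set.subset_insert _ _).trans hsub)
      have hy : y ∈ l := hsub (Set.mem_insert _ _)
      obtain ⟨u, hu, hur⟩ := ext _ _ (hconn y hy).1 hml m rfl
      obtain ⟨v, hv, hvr⟩ := ext _ _ (hconn y hy).2 hy _ hu
      refine ⟨d ++ (u ++ v), ?_, ?_, ?_⟩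
      · rw [run_append, run_append, hd, huniq _ hv]
      · rw [pathStates_append, pathStates_append, hd, Set.image_union, Set.image_union]
        exact Set.insert_subset (Or.inr (Or.inl ⟨_, end_mem T m u, hu⟩))
          (fun z hz => Or.inl (hdY hz))
      · rw [pathStates_append, pathStates_append, hd, Set.image_union, Set.image_union]
        have := rabin_union hdr (rabin_union hur hvr)
        convert this using 2
        ext z; simp only [Set.mem_union]; tauto
  obtain ⟨d, hd, hdL, hdr⟩ := cover L (List.finite_toSet l) subset_rfl
  refine ⟨d, hd, ?_⟩
  rwa [Set.union_eq_left.2 hdL] at hdr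

end Helpers

/-- For a strongly tight GFG Rabin automaton whose language is
GFG-Büchi-realizable, no state appearing in some good set lies on a rejecting cycle
of the automaton itself. -/
theorem stmt14 {A Q Mem ι : Type} [Fintype A] [Fintype Q] [Fintype Mem] [Fintype ι]
    (M : Auto A Q) (E F : ι → Set Q) (T : Transducer A Q Mem)
    (hg : IsGFGStrategy M (RabinAcc E F) T.strategy)
    (hst : StronglyTightWrt M E F T)
    (hreal : ∃ (Q' : Type) (_ : Fintype Q') (B : Auto A Q') (β : Set Q'),
      IsGFG B (BuchiAcc β) ∧ B.Lang (BuchiAcc β) = M.Lang (RabinAcc E F))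
    (q : Q) (hq : ∃ i, q ∈ F i) :
    ¬ ∃ l : List Q, l.Chain' M.Step ∧ l.head? = l.getLast? ∧ 2 ≤ l.length ∧
        q ∈ l ∧ ¬ RabinAcc E F {x : Q | x ∈ l} := by
  rintro ⟨l, hch, hhl, hlen, hql, hrej⟩
  obtain ⟨ht, hex⟩ := hst
  obtain ⟨Q', _, B, β, hB, hL⟩ := hreal
  have h0l : l[0] = l[l.length - 1] := by
    rw [List.head?_eq_getElem?, List.getLast?_eq_getElem?, List.getElem?_eq_getElem (by omega),
      List.getElem?_eq_getElem (by omega)] at hhl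
    exact Option.some.inj hhl
  have hconn : ∀ x ∈ l, ∀ y ∈ l,
      Relation.ReflTransGen (fun x y => M.Step x y ∧ y ∈ l) x y := by
    intro x hx y hy
    obtain ⟨i, hi, rfl⟩ := List.getElem_of_mem hx
    obtain ⟨j, hj, rfl⟩ := List.getElem_of_mem hy
    have h1 := chain_rtg M.Step l hch i (l.length - 1) (by omega) (by omega)
    have h2 := chain_rtg M.Step l hch 0 j (by omega) hj
    rw [h0l] at h2
    exact h1.trans h2
  -- some reachable memory of q
  have hreach : ∃ p, T.out (T.run T.m0 p) = q := by
    have : ∃ x, M.Step q x := by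
      obtain ⟨i, hi, rfl⟩ := List.getElem_of_mem hql
      by_cases h : i + 1 < l.length
      · exact ⟨_, List.isChain_iff_getElem.1 hch i h⟩
      · have h' : i = l.length - 1 := by omega
        subst h'
        rw [← h0l]
        exact ⟨_, List.isChain_iff_getElem.1 hch 0 (by omega)⟩
    obtain ⟨x, a, ha⟩ := this
    obtain ⟨p, hp, _⟩ := ht.1 _ _ _ ha
    exact ⟨p, hp⟩
  -- the exclusive cycle, rotated
  obtain ⟨m, c, hmq, hc0, hc, hacc, hexc⟩ : ∃ (m : Mem) (c : List A), T.out m = q ∧ c ≠ [] ∧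
      T.run m c = m ∧ T.accG (RabinAcc E F) (T.pathStates m c) ∧
      ¬ T.accG (RabinAcc E F) (T.pathStates m c \ {m' : Mem | T.out m' = q}) := by
    obtain ⟨n, u, ⟨hu0, hun⟩, h1, h2⟩ := hex q hq
    have : ∃ s ∈ T.pathStates n u, T.out s = q := by
      by_contra hcon
      push Not at hcon
      apply h2
      have : T.pathStates n u \ {m' : Mem | T.out m' = q} = T.pathStates n u := by
        ext s
        exact ⟨fun h => h.1, fun h => ⟨h, hcon s h⟩⟩
      rwa [this]
    obtain ⟨s, ⟨v, ⟨v', rfl⟩, rfl⟩, hs⟩ := this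
    rw [run_append] at hun
    have hS : T.pathStates (T.run n v) (v' ++ v) = T.pathStates n (v ++ v') := by
      rw [pathStates_append, pathStates_append, hun, Set.union_comm]
    refine ⟨T.run n v, v' ++ v, hs, ?_, ?_, ?_, ?_⟩
    · intro h; apply hu0; simp at h ⊢; tauto
    · rw [run_append, hun]
    · rwa [hS]
    · rwa [hS]
  have hmreach : ∃ p, T.run T.m0 p = m := by
    obtain ⟨p, hp⟩ := hreach
    by_cases h : T.run T.m0 p = m
    · exact ⟨p, h⟩
    · obtain ⟨v, hv, _⟩ := connect M E F T ht _ _ h (hp.trans hmq.symm)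
      exact ⟨p ++ v, by rw [run_append, hv]⟩
  obtain ⟨p, hp⟩ := hmreach
  have claim1 : ∀ d, T.run m d = m → T.accG (RabinAcc E F) (T.pathStates m d) := by
    intro d hd
    by_contra hdr
    obtain ⟨i, h1, x, ⟨s, hs, rfl⟩, hF⟩ := landweber M _ T hg B β hB hL p c d m hp hc0 hc hd hacc
    rw [Set.image_union, Set.union_inter_distrib_right, Set.union_empty_iff] at h1
    have hdF : ∀ t ∈ T.pathStates m d, T.out t ∉ F i := fun t ht' hF' =>
      hdr ⟨i, h1.2, _, ⟨t, ht', rfl⟩, hF'⟩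
    rcases hs with hs | hs
    · apply hexc
      refine ⟨i, ?_, T.out s, ⟨s, ⟨hs, ?_⟩, rfl⟩, hF⟩
      · apply Set.subset_empty_iff.1
        rw [← h1.1]
        exact Set.inter_subset_inter_left _ (Set.image_mono Set.diff_subset)
      · intro h
        apply hdF m (start_mem T m d)
        rw [hmq, ← h]; exact hF
    · exact hdF s hs hF
  have huniq : ∀ m', T.out m' = T.out m → m' = m := by
    intro m' h
    by_contra hne
    obtain ⟨v, hv, hvr⟩ := connect M E F T ht _ _ (Ne.symm hne) h.symm
    obtain ⟨v', hv', hvr'⟩ := connect M E F T ht _ _ hne h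
    have := claim1 (v ++ v') (by rw [run_append, hv, hv'])
    rw [pathStates_append, hv] at this
    unfold Transducer.accG at this
    rw [Set.image_union] at this
    exact rabin_union hvr hvr' this
  subst hmq
  obtain ⟨d, hd, hdr⟩ := stmt14_core M E F T ht l m huniq hql hrej
    (fun x hx => ⟨hconn _ hql x hx, hconn x hx _ hql⟩)
  exact hdr (claim1 d hd)

end GFG
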